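/- arXiv:2507.18779 — 3 statements merged into one kernel-verified Lean document; each statement's English description precedes it below -/
import Mathlib

section
/- Let d ≥ 3 be an integer and β ≥ 8 a real number, and let G be the good-word collection of X^d_β. Then for every n ≥ 1 and every pair of words v, w ∈ G of length n, there exists a single symbol b ∈ A = {1,…,d} such that the concatenation vbw belongs to G. -/
open MeasureTheory Filter Real Set

/-- The left shift on bi-infinite sequences. -/
def shift {A : Type*} (x : ℤ → A) : ℤ → A := fun n => x (n + 1)

/-- `w` occurs as a factor (finite subword) of the bi-infinite sequence `x`. -/
def FactorOf {A : Type*} (w : List A) (x : ℤ → A) : Prop :=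
  ∃ i : ℤ, ∀ t : ℕ, (ht : t < w.length) → x (i + t) = w[t]

/-- `ℓ` is a period of the word `w`. -/
def HasPeriodN {A : Type*} (w : List A) (ℓ : ℕ) : Prop :=
  1 ≤ ℓ ∧ ℓ ≤ w.length ∧ ∀ t : ℕ, (ht : t + ℓ < w.length) →
    w[t]'(lt_of_le_of_lt (Nat.le_add_right t ℓ) ht) = w[t + ℓ]

/-- The `d`-ary `β`-free shift. -/
def betaFree (d : ℕ) (β : ℝ) : Set (ℤ → Fin d) :=
  {x | ∀ w : List (Fin d), FactorOf w x → ∀ ℓ : ℕ, HasPeriodN w ℓ → (w.length : ℝ) < β * ℓ}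

/-- The language of a shift space. -/
def language {A : Type*} (X : Set (ℤ → A)) : Set (List A) :=
  {w | ∃ x ∈ X, FactorOf w x}

/-- The words of length `n` in the language of `X`. -/
def langN {A : Type*} (X : Set (ℤ → A)) (n : ℕ) : Set (List A) :=
  {w | w ∈ language X ∧ w.length = n}

/-- The cylinder of a word. -/
def cylinder {A : Type*} (w : List A) : Set (ℤ → A) :=
  {x | ∀ t : ℕ, (ht : t < w.length) → x (t : ℤ) = w[t]}

/-- A shift space: closed and shift-invariant. -/
def IsShiftSpace {A : Type*} [TopologicalSpace A] (X : Set (ℤ → A)) : Prop :=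
  IsClosed X ∧ shift '' X = X

/-- Invariance of a measure under the shift. -/
def IsShiftInvariant {A : Type*} [MeasurableSpace A] (μ : Measure (ℤ → A)) : Prop :=
  ∀ E : Set (ℤ → A), MeasurableSet E → μ (shift ⁻¹' E) = μ E

/-- The `n`-th partition sum `H_n(μ) = Σ_w −μ[w] log μ[w]`. -/
noncomputable def cylEntropySum {A : Type*} [Fintype A] [MeasurableSpace A]
    (μ : Measure (ℤ → A)) (n : ℕ) : ℝ :=
  ∑ w : Fin n → A, Real.negMulLog (μ (cylinder (List.ofFn w))).toReal

/-- `μ` is a measure of maximal entropy on `X` (with topological entropy `h`). -/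
def IsMME {A : Type*} [Fintype A] [MeasurableSpace A]
    (X : Set (ℤ → A)) (h : ℝ) (μ : Measure (ℤ → A)) : Prop :=
  IsProbabilityMeasure μ ∧ μ X = 1 ∧ IsShiftInvariant μ ∧
    Tendsto (fun n : ℕ => cylEntropySum μ n / n) atTop (nhds h)

/-- A word is a 4-power. -/
def IsFourPower {A : Type*} (s : List A) : Prop :=
  ∃ v : List A, v ≠ [] ∧ s = v ++ v ++ v ++ v

/-- Good words: words of the language no prefix or suffix of which is a 4-power. -/
def goodWords {A : Type*} (X : Set (ℤ → A)) : Set (List A) :=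
  {w | w ∈ language X ∧ (∀ p : List A, p <+: w → ¬ IsFourPower p) ∧
       (∀ s : List A, s <:+ w → ¬ IsFourPower s)}

/-- Words of the language that are concatenations of 4-powers of words of the language. -/
def fourPowerConcat {A : Type*} (X : Set (ℤ → A)) : Set (List A) :=
  {w | w ∈ language X ∧ ∃ ps : List (List A),
      (∀ p ∈ ps, ∃ v ∈ language X, v ≠ [] ∧ p = v ++ v ++ v ++ v) ∧ w = ps.flatten}

/-- Alternating concatenation `w₁u₁w₂u₂⋯`. -/
def alternate {A : Type*} : List (List A) → List (List A) → List A
  | [], _ => []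
  | w :: _, [] => w
  | w :: ws, u :: us => w ++ u ++ alternate ws us

/-- The map deleting the first `i` and the last `k` symbols of a word. -/
def phi {A : Type*} (i k : ℕ) (w : List A) : List A := (w.drop i).take (w.length - i - k)

/-- Maximal `k` such that the first `k` symbols of `w` follow the periodic
pattern of period `ℓ` determined by the prefix of `w` of length `ℓ`. -/
noncomputable def preK {A : Type*} (w : List A) (ℓ : ℕ) : ℕ :=
  sSup {k | k ≤ w.length ∧ ∀ t < k, w[t]? = w[t % ℓ]?}

/-- `pre_ℓ(w)`: the number of times the length-`ℓ` prefix of `w` repeats at the start of `w`. -/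
noncomputable def pre {A : Type*} (w : List A) (ℓ : ℕ) : ℝ := (preK w ℓ : ℝ) / ℓ

/-- `suf_ℓ(w)`: the number of times the length-`ℓ` suffix of `w` repeats at the end of `w`. -/
noncomputable def suf {A : Type*} (w : List A) (ℓ : ℕ) : ℝ := pre w.reverse ℓ

/-- The values of `f` on the integer interval `[i, j)` have period `ℓ`. -/
def PeriodicOn {A : Type*} (f : ℤ → A) (i j ℓ : ℤ) : Prop :=
  ∀ t, i ≤ t → t + ℓ < j → f t = f (t + ℓ)

/-- The window `[a, e)` of `f` is `β`-free, with no prefix and no suffix a fourth power. -/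
structure GoodWindow {A : Type*} (β : ℝ) (f : ℤ → A) (a e : ℤ) : Prop where
  free : ∀ i j ℓ : ℤ, a ≤ i → j ≤ e → 0 < ℓ → PeriodicOn f i j ℓ → ((j - i : ℤ) : ℝ) < β * ℓ
  not_prefix : ∀ ℓ : ℤ, 0 < ℓ → a + 4 * ℓ ≤ e → ¬ PeriodicOn f a (a + 4 * ℓ) ℓ
  not_suffix : ∀ ℓ : ℤ, 0 < ℓ → a + 4 * ℓ ≤ e → ¬ PeriodicOn f (e - 4 * ℓ) e ℓ

theorem PeriodicOn.mono {A : Type*} {f g : ℤ → A} {i j i' j' ℓ : ℤ} (h : PeriodicOn f i j ℓ)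
    (hi : i ≤ i') (hj : j' ≤ j) (hℓ : 0 < ℓ) (hfg : ∀ t, i' ≤ t → t < j' → f t = g t) :
    PeriodicOn g i' j' ℓ := by
  intro t h1 h2
  rw [← hfg t h1 (by omega), ← hfg (t + ℓ) (by omega) h2]
  exact h t (by omega) (by omega)

theorem GoodWindow.congr {A : Type*} {β : ℝ} {f g : ℤ → A} {a e : ℤ} (h : GoodWindow β f a e)
    (hfg : ∀ t, a ≤ t → t < e → f t = g t) : GoodWindow β g a e where
  free i j ℓ hi hj hℓ hp := h.free i j ℓ hi hj hℓ
    (hp.mono le_rfl le_rfl hℓ fun t h1 h2 => (hfg t (by omega) (by omega)).symm)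
  not_prefix ℓ hℓ hle hp := h.not_prefix ℓ hℓ hle
    (hp.mono le_rfl le_rfl hℓ fun t h1 h2 => (hfg t (by omega) (by omega)).symm)
  not_suffix ℓ hℓ hle hp := h.not_suffix ℓ hℓ hle
    (hp.mono le_rfl le_rfl hℓ fun t h1 h2 => (hfg t (by omega) (by omega)).symm)

theorem PeriodicOn.comp_add {A : Type*} {f : ℤ → A} {i j ℓ s : ℤ}
    (h : PeriodicOn (fun t => f (t + s)) i j ℓ) : PeriodicOn f (i + s) (j + s) ℓ := by
  intro t h1 h2
  have := h (t - s) (by omega) (by omega)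
  simp only [sub_add_cancel] at this
  rw [this]
  congr 1
  ring

theorem GoodWindow.comp_add {A : Type*} {β : ℝ} {f : ℤ → A} {a e : ℤ} (h : GoodWindow β f a e)
    (s : ℤ) : GoodWindow β (fun t => f (t + s)) (a - s) (e - s) where
  free i j ℓ hi hj hℓ hp := by
    have := h.free (i + s) (j + s) ℓ (by omega) (by omega) hℓ hp.comp_add
    rwa [show j + s - (i + s) = j - i by ring] at this
  not_prefix ℓ hℓ hle hp := by
    refine h.not_prefix ℓ hℓ (by omega) ?_
    convert hp.comp_add using 1 <;> ring
  not_suffix ℓ hℓ hle hp := by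
    refine h.not_suffix ℓ hℓ (by omega) ?_
    convert hp.comp_add using 1 <;> ring

theorem exists_not_or_of_three {d : ℕ} (hd : 3 ≤ d) {P Q : Fin d → Prop}
    (hP : ∀ b b', P b → P b' → b = b') (hQ : ∀ b b', Q b → Q b' → b = b') :
    ∃ b, ¬ P b ∧ ¬ Q b := by
  by_contra! h
  have h01 : (⟨0, by omega⟩ : Fin d) ≠ ⟨1, by omega⟩ := by simp
  have h02 : (⟨0, by omega⟩ : Fin d) ≠ ⟨2, by omega⟩ := by simp
  have h12 : (⟨1, by omega⟩ : Fin d) ≠ ⟨2, by omega⟩ := by simp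
  have a0 := h ⟨0, by omega⟩
  have a1 := h ⟨1, by omega⟩
  have a2 := h ⟨2, by omega⟩
  have p01 := mt (fun k : _ ∧ _ => hP _ _ k.1 k.2) h01
  have p02 := mt (fun k : _ ∧ _ => hP _ _ k.1 k.2) h02
  have p12 := mt (fun k : _ ∧ _ => hP _ _ k.1 k.2) h12
  have q01 := mt (fun k : _ ∧ _ => hQ _ _ k.1 k.2) h01
  have q02 := mt (fun k : _ ∧ _ => hQ _ _ k.1 k.2) h02
  have q12 := mt (fun k : _ ∧ _ => hQ _ _ k.1 k.2) h12
  tauto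

theorem GoodWindow.glue {d : ℕ} (hd : 3 ≤ d) {β : ℝ} (hβ : 8 ≤ β) {f : ℤ → Fin d} {a c e : ℤ}
    (hlen : c - a = e - (c + 1))
    (hv : GoodWindow β f a c) (hw : GoodWindow β f (c + 1) e) :
    ∃ b, GoodWindow β (Function.update f c b) a e := by
  have hf : ∀ b t, t ≠ c → Function.update f c b t = f t := fun b t ht => by simp [ht]
  have hc : ∀ b, Function.update f c b c = b := fun b => by simp
  obtain ⟨b, hb, hb'⟩ := exists_not_or_of_three hd
    (P := fun b => ∃ ℓ : ℤ, 0 < ℓ ∧ a + 4 * ℓ ≤ e ∧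
      PeriodicOn (Function.update f c b) a (a + 4 * ℓ) ℓ)
    (Q := fun b => ∃ ℓ : ℤ, 0 < ℓ ∧ a + 4 * ℓ ≤ e ∧
      PeriodicOn (Function.update f c b) (e - 4 * ℓ) e ℓ)
    (by
      have key : ∀ b ℓ, 0 < ℓ → a + 4 * ℓ ≤ e →
          PeriodicOn (Function.update f c b) a (a + 4 * ℓ) ℓ →
          f (c - ℓ) = b ∧ PeriodicOn f a c ℓ := by
        intro b ℓ hℓ hle hp
        have hlong : c < a + 4 * ℓ := by
          by_contra! hcon
          exact hv.not_prefix ℓ hℓ hcon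
            (hp.mono le_rfl le_rfl hℓ fun t _ _ => hf b t (by omega))
        refine ⟨?_, hp.mono le_rfl hlong.le hℓ fun t _ _ => hf b t (by omega)⟩
        have := hp (c - ℓ) (by omega) (by omega)
        rwa [sub_add_cancel, hc, hf b _ (by omega)] at this
      rintro b b' ⟨ℓ, hℓ, hle, hp⟩ ⟨m, hm, hme, hq⟩
      obtain ⟨h1, h2⟩ := key b ℓ hℓ hle hp
      obtain ⟨h3, h4⟩ := key b' m hm hme hq
      have e1 := h2 (c - m - ℓ) (by omega) (by omega)
      have e2 := h4 (c - ℓ - m) (by omega) (by omega)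
      rw [sub_add_cancel] at e1 e2
      rw [← h1, ← h3, ← e1, ← e2, sub_right_comm])
    (by
      have key : ∀ b ℓ, 0 < ℓ → a + 4 * ℓ ≤ e →
          PeriodicOn (Function.update f c b) (e - 4 * ℓ) e ℓ →
          f (c + ℓ) = b ∧ PeriodicOn f (c + 1) e ℓ := by
        intro b ℓ hℓ hle hp
        have hlong : e - 4 * ℓ < c + 1 := by
          by_contra! hcon
          exact hw.not_suffix ℓ hℓ (by omega)
            (hp.mono le_rfl le_rfl hℓ fun t _ _ => hf b t (by omega))
        refine ⟨?_, hp.mono hlong.le le_rfl hℓ fun t _ _ => hf b t (by omega)⟩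
        have := hp c (by omega) (by omega)
        rw [hc, hf b _ (by omega)] at this
        exact this.symm
      rintro b b' ⟨ℓ, hℓ, hle, hp⟩ ⟨m, hm, hme, hq⟩
      obtain ⟨h1, h2⟩ := key b ℓ hℓ hle hp
      obtain ⟨h3, h4⟩ := key b' m hm hme hq
      have e1 := h2 (c + m) (by omega) (by omega)
      have e2 := h4 (c + ℓ) (by omega) (by omega)
      rw [← h1, ← h3, e1, e2, add_right_comm])
  refine ⟨b, ⟨?_, fun ℓ hℓ hle hp => hb ⟨ℓ, hℓ, hle, hp⟩,
    fun ℓ hℓ hle hp => hb' ⟨ℓ, hℓ, hle, hp⟩⟩⟩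
  intro i j ℓ hi hj hℓ hp
  by_cases hjc : j ≤ c
  · exact hv.free i j ℓ hi hjc hℓ (hp.mono le_rfl le_rfl hℓ fun t _ _ => hf b t (by omega))
  by_cases hic : c + 1 ≤ i
  · exact hw.free i j ℓ hic hj hℓ (hp.mono le_rfl le_rfl hℓ fun t _ _ => hf b t (by omega))
  have hl : c < i + 4 * ℓ := by
    by_contra! hcon
    exact hv.not_suffix ℓ hℓ (by omega)
      (hp.mono (by omega) (by omega) hℓ fun t _ _ => hf b t (by omega))
  have hr : j < c + 1 + 4 * ℓ := by
    by_contra! hcon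
    exact hw.not_prefix ℓ hℓ (by omega)
      (hp.mono (by omega) (by omega) hℓ fun t _ _ => hf b t (by omega))
  have hlt : j - i < 8 * ℓ := by omega
  have hlt' : ((j - i : ℤ) : ℝ) < 8 * ℓ := by exact_mod_cast hlt
  have hℓ' : (0 : ℝ) < ℓ := by exact_mod_cast hℓ
  nlinarith

theorem GoodWindow.extend_right {d : ℕ} (hd : 3 ≤ d) {β : ℝ} (hβ : 8 ≤ β) {f : ℤ → Fin d}
    {a e : ℤ} (h : GoodWindow β f a e) :
    ∃ g : ℤ → Fin d, GoodWindow β g a (2 * e - a + 1) ∧ ∀ t, a ≤ t → t < e → g t = f t := by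
  have h' := h.comp_add (-(e - a + 1))
  obtain ⟨b, hb⟩ := GoodWindow.glue hd hβ (c := e) (e := 2 * e - a + 1) (a := a)
    (f := fun t => if t < e then f t else f (t + -(e - a + 1))) (by ring)
    (h.congr fun t _ ht => by simp [ht]) (by
      rw [show a - -(e - a + 1) = e + 1 by ring,
        show e - -(e - a + 1) = 2 * e - a + 1 by ring] at h'
      exact h'.congr fun t ht _ => by rw [if_neg (by omega)])
  refine ⟨_, hb, fun t _ ht => ?_⟩
  rw [Function.update_of_ne (by omega), if_pos ht]

theorem GoodWindow.extend_left {d : ℕ} (hd : 3 ≤ d) {β : ℝ} (hβ : 8 ≤ β) {f : ℤ → Fin d}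
    {a e : ℤ} (h : GoodWindow β f a e) :
    ∃ g : ℤ → Fin d, GoodWindow β g (2 * a - e - 1) e ∧ ∀ t, a ≤ t → t < e → g t = f t := by
  obtain ⟨b, hb⟩ := GoodWindow.glue hd hβ (c := a - 1) (e := e) (a := 2 * a - e - 1)
    (f := fun t => if a ≤ t then f t else f (t + (e - a + 1))) (by ring)
    (by
      have h' := h.comp_add (e - a + 1)
      rw [show a - (e - a + 1) = 2 * a - e - 1 by ring,
        show e - (e - a + 1) = a - 1 by ring] at h'
      exact h'.congr fun t _ ht => by rw [if_neg (by omega)])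
    (by
      rw [sub_add_cancel]
      exact h.congr fun t ht _ => by simp [ht])
  refine ⟨_, hb, fun t ht _ => ?_⟩
  rw [Function.update_of_ne (by omega), if_pos ht]

/-- A good window extends to a sequence in the `β`-free shift. -/
theorem GoodWindow.exists_mem_betaFree {d : ℕ} (hd : 3 ≤ d) {β : ℝ} (hβ : 8 ≤ β)
    {f : ℤ → Fin d} {a e : ℤ} (hae : a ≤ e) (h : GoodWindow β f a e) :
    ∃ x ∈ betaFree d β, ∀ t, a ≤ t → t < e → x t = f t := by
  let S := {p : (ℤ → Fin d) × ℤ × ℤ // p.2.1 ≤ p.2.2 ∧ GoodWindow β p.1 p.2.1 p.2.2}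
  have step : ∀ p : S, ∃ q : S, q.1.2.1 < p.1.2.1 ∧ p.1.2.2 < q.1.2.2 ∧
      ∀ t, p.1.2.1 ≤ t → t < p.1.2.2 → q.1.1 t = p.1.1 t := by
    rintro ⟨⟨f, a, e⟩, hae, h⟩
    dsimp only at hae h
    obtain ⟨g, hg, hgf⟩ := h.extend_right hd hβ
    obtain ⟨k, hk, hkg⟩ := hg.extend_left hd hβ
    refine ⟨⟨⟨k, _, _⟩, ?_, hk⟩, ?_, ?_, fun t h1 h2 => ?_⟩ <;> dsimp only at *
    · omega
    · omega
    · omega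
    · rw [hkg t h1 (by omega), hgf t h1 h2]
  choose next hleft hright hagree using step
  let u : ℕ → S := fun k => next^[k] ⟨⟨f, a, e⟩, hae, h⟩
  have hu : ∀ k, u (k + 1) = next (u k) := fun k => Function.iterate_succ_apply' _ _ _
  have ha : ∀ k : ℕ, (u k).1.2.1 ≤ a - k := by
    intro k
    induction k with
    | zero => simp [u]
    | succ k ih => have := hleft (u k); rw [hu]; push_cast; omega
  have he : ∀ k : ℕ, e + k ≤ (u k).1.2.2 := by
    intro k
    induction k with
    | zero => simp [u]
    | succ k ih => have := hright (u k); rw [hu]; push_cast; omega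
  have hstable : ∀ k m t, (u k).1.2.1 ≤ t → t < (u k).1.2.2 →
      (u k).1.2.1 ≥ (u (k + m)).1.2.1 ∧ (u k).1.2.2 ≤ (u (k + m)).1.2.2 ∧
        (u (k + m)).1.1 t = (u k).1.1 t := by
    intro k m t h1 h2
    induction m with
    | zero => simp
    | succ m ih =>
      obtain ⟨i1, i2, i3⟩ := ih
      have l := hleft (u (k + m))
      have r := hright (u (k + m))
      rw [← add_assoc, hu]
      exact ⟨by omega, by omega, by rw [hagree _ t (by omega) (by omega), i3]⟩
  let K : ℤ → ℕ := fun t => t.natAbs + a.natAbs + e.natAbs + 1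
  have hK : ∀ t m, K t ≤ m → (u m).1.1 t = (u (K t)).1.1 t := by
    intro t m hm
    obtain ⟨r, rfl⟩ := Nat.exists_eq_add_of_le hm
    have h1 := ha (K t)
    have h2 := he (K t)
    have h3 : ((K t : ℕ) : ℤ) = t.natAbs + a.natAbs + e.natAbs + 1 := by simp [K]
    exact (hstable (K t) r t (by omega) (by omega)).2.2
  refine ⟨fun t => (u (K t)).1.1 t, ?_, fun t h1 h2 => ?_⟩
  · rintro w ⟨i, hi⟩ ℓ ⟨hℓ, -, hp⟩
    let M : ℕ := i.natAbs + w.length + a.natAbs + e.natAbs + 1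
    have hM : ∀ t : ℕ, (ht : t < w.length) → (u M).1.1 (i + t) = w[t] := by
      intro t ht
      rw [hK (i + t) M (by simp only [K, M]; omega)]
      exact hi t ht
    have h1 := ha M
    have h2 := he M
    have h3 : (M : ℤ) = i.natAbs + w.length + a.natAbs + e.natAbs + 1 := by simp [M]
    have := (u M).2.2.free i (i + w.length) ℓ (by omega) (by omega) (by omega) (by
      intro t ht1 ht2
      obtain ⟨s, rfl⟩ := Int.exists_add_of_le ht1
      rw [hM s (by omega), add_assoc]
      have := hM (s + ℓ) (by omega)
      push_cast at this
      rw [this]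
      exact hp s (by omega))
    simpa using this
  · have := (hstable 0 (K t) t h1 h2).2.2
    rwa [zero_add] at this

theorem isFourPower_iff {A : Type*} (s : List A) :
    IsFourPower s ↔ ∃ ℓ : ℕ, 0 < ℓ ∧ s.length = 4 * ℓ ∧ ∀ t, t + ℓ < 4 * ℓ → s[t]? = s[t + ℓ]? := by
  constructor
  · rintro ⟨v, hv, rfl⟩
    refine ⟨v.length, List.length_pos_iff.2 hv, by simp; omega, fun t ht => ?_⟩
    grind
  · rintro ⟨ℓ, hℓ, hs, hp⟩
    have h1 : ∀ t < ℓ, s[t + ℓ]? = s[t]? := fun t ht => (hp t (by omega)).symm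
    have h2 : ∀ t < ℓ, s[t + ℓ + ℓ]? = s[t]? := fun t ht => by
      rw [← hp (t + ℓ) (by omega), h1 t ht]
    have h3 : ∀ t < ℓ, s[t + ℓ + ℓ + ℓ]? = s[t]? := fun t ht => by
      rw [← hp (t + ℓ + ℓ) (by omega), h2 t ht]
    refine ⟨s.take ℓ, ?_, ?_⟩
    · rw [← List.length_pos_iff]
      simp
      omega
    · have hlen : (s.take ℓ).length = ℓ := by simp; omega
      have hleft : ∀ u, ∀ t < ℓ, (s.take ℓ ++ u)[t]? = s[t]? := fun u t ht => by
        rw [List.getElem?_append_left (by omega), List.getElem?_take_of_lt ht]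
      have hright : ∀ u t, (s.take ℓ ++ u)[t + ℓ]? = u[t]? := fun u t => by
        rw [List.getElem?_append_right (by omega), hlen, Nat.add_sub_cancel]
      rw [List.append_assoc, List.append_assoc]
      apply List.ext_getElem?
      intro t
      rcases lt_or_ge t ℓ with h | h
      · rw [hleft _ t h]
      obtain ⟨t, rfl⟩ := Nat.exists_eq_add_of_le' h
      rw [hright]
      rcases lt_or_ge t ℓ with h | h
      · rw [hleft _ t h, h1 t h]
      obtain ⟨t, rfl⟩ := Nat.exists_eq_add_of_le' h
      rw [hright]
      rcases lt_or_ge t ℓ with h | h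
      · rw [hleft _ t h, h2 t h]
      obtain ⟨t, rfl⟩ := Nat.exists_eq_add_of_le' h
      rcases lt_or_ge t ℓ with h | h
      · rw [hright, List.getElem?_take_of_lt h, h3 t h]
      · rw [List.getElem?_eq_none (by omega), List.getElem?_eq_none (by simp; omega)]

theorem exists_prefix_isFourPower_iff {A : Type*} {w : List A} {f : ℤ → A} {a : ℤ}
    (hf : ∀ t : ℕ, (ht : t < w.length) → f (a + t) = w[t]) :
    (∃ p, p <+: w ∧ IsFourPower p) ↔
      ∃ ℓ : ℤ, 0 < ℓ ∧ a + 4 * ℓ ≤ a + w.length ∧ PeriodicOn f a (a + 4 * ℓ) ℓ := by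
  constructor
  · rintro ⟨p, ⟨q, rfl⟩, hp⟩
    obtain ⟨ℓ, hℓ, hs, hper⟩ := (isFourPower_iff p).1 hp
    have hlen : (p ++ q).length = p.length + q.length := by simp
    refine ⟨ℓ, by omega, by omega, fun t h1 h2 => ?_⟩
    obtain ⟨s, rfl⟩ := Int.exists_add_of_le h1
    have e2 := hf (s + ℓ) (by omega)
    push_cast at e2
    rw [add_assoc, e2, hf s (by omega)]
    have := hper s (by omega)
    grind
  · rintro ⟨ℓ, hℓ, hle, hp⟩
    lift ℓ to ℕ using hℓ.le
    refine ⟨w.take (4 * ℓ), List.take_prefix _ _, (isFourPower_iff _).2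
      ⟨ℓ, by omega, by simp; omega, fun t ht => ?_⟩⟩
    have := hp (a + t) (by omega) (by omega)
    have e2 := hf (t + ℓ) (by omega)
    push_cast at e2
    rw [add_assoc, e2, hf t (by omega)] at this
    grind

theorem exists_suffix_isFourPower_iff {A : Type*} {w : List A} {f : ℤ → A} {a : ℤ}
    (hf : ∀ t : ℕ, (ht : t < w.length) → f (a + t) = w[t]) :
    (∃ p, p <:+ w ∧ IsFourPower p) ↔
      ∃ ℓ : ℤ, 0 < ℓ ∧ a + 4 * ℓ ≤ a + w.length ∧
        PeriodicOn f (a + w.length - 4 * ℓ) (a + w.length) ℓ := by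
  constructor
  · rintro ⟨p, ⟨q, rfl⟩, hp⟩
    obtain ⟨ℓ, hℓ, hs, hper⟩ := (isFourPower_iff p).1 hp
    have hlen : (q ++ p).length = q.length + p.length := by simp
    refine ⟨ℓ, by omega, by omega, fun t h1 h2 => ?_⟩
    obtain ⟨s, rfl⟩ : ∃ s : ℕ, t = a + (q.length + s : ℕ) :=
      ⟨(t - a - q.length).toNat, by omega⟩
    have e2 := hf (q.length + s + ℓ) (by omega)
    rw [Nat.cast_add] at e2
    rw [add_assoc, e2, hf (q.length + s) (by omega)]
    have := hper s (by omega)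
    grind
  · rintro ⟨ℓ, hℓ, hle, hp⟩
    lift ℓ to ℕ using hℓ.le
    refine ⟨w.drop (w.length - 4 * ℓ), List.drop_suffix _ _, (isFourPower_iff _).2
      ⟨ℓ, by omega, by simp; omega, fun t ht => ?_⟩⟩
    have := hp (a + (w.length - 4 * ℓ + t : ℕ)) (by omega) (by omega)
    have e2 := hf (w.length - 4 * ℓ + t + ℓ) (by omega)
    rw [Nat.cast_add] at e2
    rw [add_assoc, e2, hf (w.length - 4 * ℓ + t) (by omega)] at this
    grind

theorem goodWindow_of_mem_goodWords {d : ℕ} {β : ℝ} (hβ : 8 ≤ β) {w : List (Fin d)}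
    (hw : w ∈ goodWords (betaFree d β)) {f : ℤ → Fin d} {a : ℤ}
    (hf : ∀ t : ℕ, (ht : t < w.length) → f (a + t) = w[t]) :
    GoodWindow β f a (a + w.length) := by
  obtain ⟨⟨x, hx, k, hk⟩, hpre, hsuf⟩ := hw
  refine ⟨fun i j ℓ hi hj hℓ hp => ?_, fun ℓ hℓ hle hp => ?_, fun ℓ hℓ hle hp => ?_⟩
  · have hℓ' : (0 : ℝ) < ℓ := by exact_mod_cast hℓ
    by_cases hshort : j - i < ℓ
    · have : ((j - i : ℤ) : ℝ) < ℓ := by exact_mod_cast hshort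
      nlinarith
    lift ℓ to ℕ using hℓ.le
    obtain ⟨m, rfl⟩ : ∃ m : ℕ, j = i + m := ⟨(j - i).toNat, by omega⟩
    obtain ⟨s, rfl⟩ := Int.exists_add_of_le hi
    have := hx (List.ofFn fun t : Fin m => f (a + s + (t : ℕ)))
      ⟨k + s, fun t ht => by
        rw [List.length_ofFn] at ht
        have e1 := hk (s + t) (by omega)
        have e2 := hf (s + t) (by omega)
        push_cast at e1 e2
        simp only [List.getElem_ofFn]
        rw [add_assoc, add_assoc, e1, e2]⟩ ℓ
      ⟨by omega, by simp; omega, fun t ht => by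
        rw [List.length_ofFn] at ht
        simp only [List.getElem_ofFn]
        rw [hp _ (by omega) (by omega)]
        push_cast
        rw [add_assoc]⟩
    simpa using this
  · obtain ⟨p, h1, h2⟩ := (exists_prefix_isFourPower_iff hf).2 ⟨ℓ, hℓ, hle, hp⟩
    exact hpre p h1 h2
  · obtain ⟨p, h1, h2⟩ := (exists_suffix_isFourPower_iff hf).2 ⟨ℓ, hℓ, hle, hp⟩
    exact hsuf p h1 h2

theorem mem_goodWords_of_goodWindow {d : ℕ} (hd : 3 ≤ d) {β : ℝ} (hβ : 8 ≤ β)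
    {w : List (Fin d)} {f : ℤ → Fin d} {a : ℤ}
    (hf : ∀ t : ℕ, (ht : t < w.length) → f (a + t) = w[t])
    (h : GoodWindow β f a (a + w.length)) : w ∈ goodWords (betaFree d β) := by
  obtain ⟨x, hx, hxf⟩ := h.exists_mem_betaFree hd hβ (by omega)
  refine ⟨⟨x, hx, a, fun t ht => ?_⟩, fun p h1 h2 => ?_, fun p h1 h2 => ?_⟩
  · rw [hxf _ (by omega) (by omega), hf t ht]
  · obtain ⟨ℓ, hℓ, hle, hp⟩ := (exists_prefix_isFourPower_iff hf).1 ⟨p, h1, h2⟩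
    exact h.not_prefix ℓ hℓ hle hp
  · obtain ⟨ℓ, hℓ, hle, hp⟩ := (exists_suffix_isFourPower_iff hf).1 ⟨p, h1, h2⟩
    exact h.not_suffix ℓ hℓ hle hp

/-- Same-length specification with a one-symbol gap, for `d ≥ 3` and `β ≥ 8`. -/
theorem same_length_spec_one_symbol (d : ℕ) (hd : 3 ≤ d) (β : ℝ) (hβ : 8 ≤ β) :
    ∀ n : ℕ, 1 ≤ n → ∀ v w : List (Fin d),
      v ∈ goodWords (betaFree d β) → w ∈ goodWords (betaFree d β) →
      v.length = n → w.length = n →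
      ∃ b : Fin d, v ++ [b] ++ w ∈ goodWords (betaFree d β) := by
  intro n _ v w hv hw hvn hwn
  have hd0 : 0 < d := by omega
  let f : ℤ → Fin d := fun t => (v ++ [⟨0, hd0⟩] ++ w : List (Fin d)).getD t.toNat ⟨0, hd0⟩
  have h1 : GoodWindow β f 0 (0 + v.length) := goodWindow_of_mem_goodWords hβ hv fun t ht => by
    simp only [f, zero_add, Int.toNat_natCast]
    grind
  have h2 : GoodWindow β f (n + 1) (n + 1 + w.length) :=
    goodWindow_of_mem_goodWords hβ hw fun t ht => by
      simp only [f]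
      rw [show ((n : ℤ) + 1 + t).toNat = n + 1 + t by omega]
      grind
  obtain ⟨b, hb⟩ := GoodWindow.glue hd hβ (f := f) (a := 0) (c := n) (e := n + 1 + w.length)
    (by omega) (by rwa [hvn, zero_add] at h1) h2
  refine ⟨b, mem_goodWords_of_goodWindow hd hβ (a := 0) (f := Function.update f n b)
    (fun t ht => ?_) ?_⟩
  · rw [zero_add]
    rcases eq_or_ne t n with rfl | htn
    · rw [Function.update_self]
      grind
    · rw [Function.update_of_ne (by exact_mod_cast htn)]
      simp only [f, Int.toNat_natCast]
      grind
  · convert hb using 1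
    simp
    omega
end

section
/- Let L and G be the language and good-word collection of X^d_β. If d ≥ 3 and β ≥ 12 (β real), then for every u, v, w, x ∈ G there exist symbols a, b, c ∈ A = {1,…,d} such that uavbwcx ∈ L. If d = 2 and β > 12 (β real), then for every u, v, w, x ∈ G there exist words p, q, r of length 2 over A such that upvqwrx ∈ L. -/
open MeasureTheory Filter Real Set

/-- The values of `y` at the integers in `[s, e)` have period `ℓ`. -/
def RunOn {A : Type*} (y : ℤ → A) (ℓ : ℕ) (s e : ℤ) : Prop :=
  ∀ i : ℤ, s ≤ i → i + ℓ < e → y i = y (i + ℓ)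

/-- The word `w` occurs in `y` at position `a`. -/
def OccursAt {A : Type*} (y : ℤ → A) (w : List A) (a : ℤ) : Prop :=
  ∀ t : ℕ, (ht : t < w.length) → y (a + t) = w[t]

theorem RunOn.mono {A : Type*} {y : ℤ → A} {ℓ : ℕ} {s e s' e' : ℤ} (h : RunOn y ℓ s e)
    (hs : s ≤ s') (he : e' ≤ e) : RunOn y ℓ s' e' :=
  fun i h1 h2 => h i (by omega) (by omega)

theorem OccursAt.append {A : Type*} {y : ℤ → A} {w₁ w₂ : List A} {a : ℤ}
    (h : OccursAt y (w₁ ++ w₂) a) : OccursAt y w₁ a ∧ OccursAt y w₂ (a + w₁.length) := by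
  constructor
  · intro t ht
    rw [h t (by simp; omega), List.getElem_append_left ht]
  · intro t ht
    have := h (w₁.length + t) (by simp; omega)
    rw [List.getElem_append_right (by omega)] at this
    simpa [add_assoc] using this

/-- Overlap-freeness: every run of period `ℓ` has length at most `2 * ℓ`. -/
def OverlapFree {A : Type*} (t : ℕ → A) : Prop :=
  ∀ s ℓ : ℕ, 1 ≤ ℓ → ∃ i, s ≤ i ∧ i ≤ s + ℓ ∧ t i ≠ t (i + ℓ)

/-- The Thue–Morse sequence. -/
def thueMorse : ℕ → Bool
  | 0 => false
  | n + 1 => xor (thueMorse ((n + 1) / 2)) ((n + 1) % 2 == 1)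
decreasing_by omega

theorem thueMorse_two_mul (n : ℕ) : thueMorse (2 * n) = thueMorse n := by
  rcases n with _ | n
  · rfl
  · rw [show 2 * (n + 1) = (2 * n + 1) + 1 by ring, thueMorse]
    have h1 : (2 * n + 1 + 1) / 2 = n + 1 := by omega
    have h2 : (2 * n + 1 + 1) % 2 = 0 := by omega
    simp [h1, h2]

theorem thueMorse_two_mul_add_one (n : ℕ) : thueMorse (2 * n + 1) = !thueMorse n := by
  rw [thueMorse]
  have h1 : (2 * n + 1) / 2 = n := by omega
  have h2 : (2 * n + 1) % 2 = 1 := by omega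
  simp [h1, h2]

theorem thueMorse_succ_ne {n : ℕ} (hn : n % 2 = 0) : thueMorse (n + 1) = !thueMorse n := by
  obtain ⟨k, rfl⟩ : ∃ k, n = 2 * k := ⟨n / 2, by omega⟩
  rw [thueMorse_two_mul_add_one, thueMorse_two_mul]

theorem overlapFree_thueMorse : OverlapFree thueMorse := by
  intro s ℓ
  induction ℓ using Nat.strong_induction_on generalizing s with
  | _ ℓ ih =>
    intro hℓ
    by_contra! hcon
    rcases Nat.even_or_odd' ℓ with ⟨k, rfl | rfl⟩
    · obtain ⟨i, h1, h2, h3⟩ := ih k (by omega) (s / 2) (by omega)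
      rcases Nat.mod_two_eq_zero_or_one s with hs | hs
      · have := hcon (2 * i) (by omega) (by omega)
        rw [← mul_add, thueMorse_two_mul, thueMorse_two_mul] at this
        exact h3 this
      · have := hcon (2 * i + 1) (by omega) (by omega)
        rw [show 2 * i + 1 + 2 * k = 2 * (i + k) + 1 by ring, thueMorse_two_mul_add_one,
          thueMorse_two_mul_add_one] at this
        exact h3 (by simpa using this)
    · have alt : ∀ j, j ≤ 2 * k + 1 →
          thueMorse (s + j) = xor (thueMorse s) (j % 2 == 1) := by
        intro j
        induction j with
        | zero => simp
        | succ j ihj =>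
          intro hj
          have step : thueMorse (s + j + 1) = !thueMorse (s + j) := by
            rcases Nat.mod_two_eq_zero_or_one (s + j) with h | h
            · exact thueMorse_succ_ne h
            · rw [hcon (s + j + 1) (by omega) (by omega), hcon (s + j) (by omega) (by omega),
                show s + j + 1 + (2 * k + 1) = s + j + (2 * k + 1) + 1 by ring]
              exact thueMorse_succ_ne (by omega)
          rw [← add_assoc, step, ihj (by omega)]
          rcases Nat.mod_two_eq_zero_or_one j with h | h
          · simp [h, show (j + 1) % 2 = 1 by omega]
          · simp [h, show (j + 1) % 2 = 0 by omega]
      have h1 := alt (2 * k + 1) le_rfl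
      rw [← hcon s le_rfl (by omega), show (2 * k + 1) % 2 = 1 by omega] at h1
      simp at h1

theorem exists_overlapFree {d : ℕ} (hd : 2 ≤ d) : ∃ t : ℕ → Fin d, OverlapFree t := by
  refine ⟨fun n => if thueMorse n then ⟨1, by omega⟩ else ⟨0, by omega⟩, fun s ℓ hℓ => ?_⟩
  obtain ⟨i, h1, h2, h3⟩ := overlapFree_thueMorse s ℓ hℓ
  refine ⟨i, h1, h2, ?_⟩
  dsimp only
  revert h3
  cases thueMorse i <;> cases thueMorse (i + ℓ) <;> simp

/-- The bi-infinite sequence carrying `W` at position `0` and mirrored copies of `t` outside. -/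
def extendBy {A : Type*} (t : ℕ → A) (W : List A) : ℤ → A := fun j =>
  if h : 0 ≤ j ∧ j < W.length then W[j.toNat]'(by omega) else t j.natAbs

theorem occursAt_extendBy {A : Type*} (t : ℕ → A) (W : List A) :
    OccursAt (extendBy t W) W 0 := by
  intro n hn
  have : 0 ≤ (0 : ℤ) + n ∧ (0 : ℤ) + n < W.length := by omega
  simp only [extendBy, this, and_self, dif_pos]
  congr 1
  omega

theorem extendBy_of_notMem {A : Type*} (t : ℕ → A) (W : List A) {j : ℤ}
    (h : j < 0 ∨ (W.length : ℤ) ≤ j) : extendBy t W j = t j.natAbs := by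
  rw [extendBy, dif_neg (by omega)]

theorem run_left_le {A : Type*} {t : ℕ → A} (ht : OverlapFree t) (W : List A) {ℓ : ℕ}
    (hℓ : 1 ≤ ℓ) {s e : ℤ} (he : e ≤ 0) (h : RunOn (extendBy t W) ℓ s e) : e - s ≤ 2 * ℓ := by
  by_contra! hc
  obtain ⟨i, h1, h2, h3⟩ := ht (1 - e).toNat ℓ hℓ
  apply h3
  have := h (-(i + ℓ)) (by omega) (by omega)
  rw [extendBy_of_notMem _ _ (by omega), extendBy_of_notMem _ _ (by omega)] at this
  rw [show (-((i : ℤ) + ℓ)).natAbs = i + ℓ by omega,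
    show (-((i : ℤ) + ℓ) + ℓ).natAbs = i by omega] at this
  exact this.symm

theorem run_right_le {A : Type*} {t : ℕ → A} (ht : OverlapFree t) (W : List A) {ℓ : ℕ}
    (hℓ : 1 ≤ ℓ) {s e : ℤ} (hs : (W.length : ℤ) ≤ s) (h : RunOn (extendBy t W) ℓ s e) :
    e - s ≤ 2 * ℓ := by
  by_contra! hc
  obtain ⟨i, h1, h2, h3⟩ := ht s.toNat ℓ hℓ
  apply h3
  have := h i (by omega) (by omega)
  rw [extendBy_of_notMem _ _ (by omega), extendBy_of_notMem _ _ (by omega)] at this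
  rwa [show ((i : ℤ)).natAbs = i by omega, show ((i : ℤ) + ℓ).natAbs = i + ℓ by omega] at this

theorem isFourPower_of_period {A : Type*} {w : List A} {ℓ : ℕ} (hℓ : 1 ≤ ℓ)
    (hw : w.length = 4 * ℓ)
    (h : ∀ t : ℕ, (ht : t + ℓ < w.length) → w[t]'(by omega) = w[t + ℓ]) : IsFourPower w := by
  have key : ∀ k, k + ℓ + ℓ ≤ 4 * ℓ → (w.drop (k + ℓ)).take ℓ = (w.drop k).take ℓ := by
    intro k hk
    apply List.ext_getElem
    · simp; omega
    · intro n h1 h2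
      simp only [List.length_take, List.length_drop] at h1
      simp only [List.getElem_take, List.getElem_drop]
      rw [h (k + n) (by omega)]
      congr 1
      omega
  refine ⟨w.take ℓ, ?_, ?_⟩
  · intro h0
    have := congrArg List.length h0
    rw [List.length_take, List.length_nil] at this
    omega
  · have e1 := key 0 (by omega)
    have e2 := key ℓ (by omega)
    have e3 := key (ℓ + ℓ) (by omega)
    have e4 : (w.drop (ℓ + ℓ + ℓ)).take ℓ = w.drop (ℓ + ℓ + ℓ) :=
      List.take_of_length_le (by simp; omega)
    simp only [List.drop_zero, zero_add] at e1
    rw [e1] at e2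
    rw [e2] at e3
    rw [e3] at e4
    calc w = w.take ℓ ++ ((w.drop ℓ).take ℓ ++ ((w.drop (ℓ + ℓ)).take ℓ ++
          w.drop (ℓ + ℓ + ℓ))) := by
          rw [← List.drop_drop (i := ℓ) (j := ℓ + ℓ), List.take_append_drop,
            ← List.drop_drop (i := ℓ) (j := ℓ), List.take_append_drop, List.take_append_drop]
      _ = _ := by rw [e1, e2, ← e4]; simp

theorem run_prefix_lt {A : Type*} {y : ℤ → A} {w : List A} {a : ℤ} (ho : OccursAt y w a)
    (hw : ∀ p : List A, p <+: w → ¬ IsFourPower p) {ℓ : ℕ} (hℓ : 1 ≤ ℓ) {e : ℤ}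
    (he : e ≤ a + w.length) (h : RunOn y ℓ a e) : e - a < 4 * ℓ := by
  by_contra! hc
  refine hw (w.take (4 * ℓ)) (List.take_prefix _ _) (isFourPower_of_period hℓ ?_ ?_)
  · simp; omega
  · intro t ht
    simp only [List.length_take] at ht
    simp only [List.getElem_take]
    rw [← ho, ← ho, h _ (by omega) (by omega)]
    congr 1
    push_cast
    ring

theorem run_suffix_lt {A : Type*} {y : ℤ → A} {w : List A} {a : ℤ} (ho : OccursAt y w a)
    (hw : ∀ p : List A, p <:+ w → ¬ IsFourPower p) {ℓ : ℕ} (hℓ : 1 ≤ ℓ) {s : ℤ}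
    (hs : a ≤ s) (h : RunOn y ℓ s (a + w.length)) : a + w.length - s < 4 * ℓ := by
  by_contra! hc
  refine hw (w.drop (w.length - 4 * ℓ)) (List.drop_suffix _ _) (isFourPower_of_period hℓ ?_ ?_)
  · simp; omega
  · intro t ht
    simp only [List.length_drop] at ht
    simp only [List.getElem_drop]
    rw [← ho, ← ho, h _ (by omega) (by omega)]
    congr 1
    push_cast
    ring

theorem run_inside_lt {d : ℕ} {β : ℝ} {y : ℤ → Fin d} {w : List (Fin d)} {a : ℤ}
    (ho : OccursAt y w a) (hw : w ∈ language (betaFree d β)) {ℓ : ℕ} (hℓ : 1 ≤ ℓ) {s : ℤ} {n : ℕ}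
    (hs : a ≤ s) (he : s + n ≤ a + w.length) (hn : ℓ ≤ n) (h : RunOn y ℓ s (s + n)) :
    (n : ℝ) < β * ℓ := by
  obtain ⟨z, hz, i, hi⟩ := hw
  have hlen : ((w.drop (s - a).toNat).take n).length = n := by simp; omega
  have := hz ((w.drop (s - a).toNat).take n) ⟨i + (s - a).toNat, ?_⟩ ℓ ⟨hℓ, by omega, ?_⟩
  · rwa [hlen] at this
  · intro t ht
    rw [hlen] at ht
    rw [List.getElem_take, List.getElem_drop, ← hi]
    congr 1
    push_cast
    ring
  · intro t ht
    rw [hlen] at ht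
    simp only [List.getElem_take, List.getElem_drop]
    rw [← ho, ← ho, h _ (by omega) (by omega)]
    congr 1
    push_cast
    ring

theorem exists_run_of_notMem {d : ℕ} {β : ℝ} {y : ℤ → Fin d} (hy : y ∉ betaFree d β) :
    ∃ ℓ n : ℕ, ∃ s : ℤ, 1 ≤ ℓ ∧ ℓ ≤ n ∧ β * ℓ ≤ n ∧ RunOn y ℓ s (s + n) := by
  simp only [betaFree, mem_ofPred_eq, not_forall, not_lt] at hy
  obtain ⟨w, ⟨i, hi⟩, ℓ, ⟨h1, h2, h3⟩, h4⟩ := hy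
  refine ⟨ℓ, w.length, i, h1, h2, h4, fun j hj hj' => ?_⟩
  have e1 := hi (j - i).toNat (by omega)
  have e2 := hi ((j - i).toNat + ℓ) (by omega)
  rw [← h3 _ (by omega), ← e1] at e2
  rw [show i + ((j - i).toNat : ℤ) = j by omega,
    show i + (((j - i).toNat + ℓ : ℕ) : ℤ) = j + ℓ by omega] at e2
  exact e2.symm

/-- Two sequences that agree left of `m` and have, across `[m, m + g)`, runs of periods `ℓ` and
`ℓ'` which both start at least `ℓ + ℓ'` before `m`, agree on `[m, m + g)`. -/
theorem eq_of_runs_left {A : Type*} {y y' : ℤ → A} {m s s' e e' : ℤ} {g ℓ ℓ' : ℕ}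
    (hℓ : 1 ≤ ℓ) (hℓ' : 1 ≤ ℓ') (hyy : ∀ i < m, y i = y' i)
    (h : RunOn y ℓ s e) (h' : RunOn y' ℓ' s' e') (hs : s ≤ m - ℓ - ℓ') (hs' : s' ≤ m - ℓ - ℓ')
    (he : m + g ≤ e) (he' : m + g ≤ e') : ∀ k : ℕ, k < g → y (m + k) = y' (m + k) := by
  intro k
  induction k using Nat.strong_induction_on with
  | _ k ih =>
    intro hk
    have low : ∀ i < m + k, y i = y' i := by
      intro i hi
      rcases lt_or_ge i m with h1 | h1
      · exact hyy i h1
      · have := ih (i - m).toNat (by omega) (by omega)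
        rwa [show m + ((i - m).toNat : ℤ) = i by omega] at this
    have a1 := h (m + k - ℓ) (by omega) (by omega)
    have a2 := h' (m + k - ℓ') (by omega) (by omega)
    have a3 := h (m + k - ℓ' - ℓ) (by omega) (by omega)
    have a4 := h' (m + k - ℓ' - ℓ) (by omega) (by omega)
    rw [show m + k - ℓ' - ℓ + (ℓ' : ℤ) = m + k - ℓ by ring] at a4
    rw [sub_add_cancel] at a1 a2 a3
    rw [← a1, ← a2, low _ (by omega), ← a4, ← low _ (by omega), a3, low _ (by omega)]

theorem eq_of_runs_right {A : Type*} {y y' : ℤ → A} {m s s' e e' : ℤ} {g ℓ ℓ' : ℕ}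
    (hℓ : 1 ≤ ℓ) (hℓ' : 1 ≤ ℓ') (hyy : ∀ i, m + g ≤ i → y i = y' i)
    (h : RunOn y ℓ s e) (h' : RunOn y' ℓ' s' e') (hs : s ≤ m) (hs' : s' ≤ m)
    (he : m + g + ℓ + ℓ' ≤ e) (he' : m + g + ℓ + ℓ' ≤ e') :
    ∀ k : ℕ, k < g → y (m + k) = y' (m + k) := by
  have refl : ∀ {z : ℤ → A} {p : ℕ} {a b : ℤ}, RunOn z p a b →
      RunOn (fun i => z (-i)) p (1 - b) (1 - a) := by
    intro z p a b hz i h1 h2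
    have := hz (-(i + p)) (by omega) (by omega)
    rw [show -(i + p) + (p : ℤ) = -i by ring] at this
    exact this.symm
  intro k hk
  have := eq_of_runs_left (m := 1 - (m + g)) (g := g) hℓ hℓ'
    (fun i hi => hyy (-i) (by omega)) (refl h) (refl h') (by omega) (by omega) (by omega)
    (by omega) (g - 1 - k) (by omega)
  simpa [show -(1 - (m + g) + ((g - 1 - k : ℕ) : ℤ)) = m + k by omega] using this

theorem eq_of_runs_same {A : Type*} {y y' : ℤ → A} {m s s' e e' : ℤ} {g ℓ : ℕ}
    (hℓ : 1 ≤ ℓ) (hyy : ∀ i < m, y i = y' i)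
    (h : RunOn y ℓ s e) (h' : RunOn y' ℓ s' e') (hs : s ≤ m - ℓ) (hs' : s' ≤ m - ℓ)
    (he : m + g ≤ e) (he' : m + g ≤ e') : ∀ k : ℕ, k < g → y (m + k) = y' (m + k) := by
  intro k
  induction k using Nat.strong_induction_on with
  | _ k ih =>
    intro hk
    have low : y (m + k - ℓ) = y' (m + k - ℓ) := by
      rcases lt_or_ge (m + k - ℓ) m with h1 | h1
      · exact hyy _ h1
      · have := ih (k - ℓ) (by omega) (by omega)
        rwa [show m + ((k - ℓ : ℕ) : ℤ) = m + k - ℓ by omega] at this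
    have a1 := h (m + k - ℓ) (by omega) (by omega)
    have a2 := h' (m + k - ℓ) (by omega) (by omega)
    rw [sub_add_cancel] at a1 a2
    rw [← a1, ← a2, low]

/-- The constraints on the length `L` of the part on one side of the middle gap of a run of
period `ℓ`, when the two words on that side have lengths `V` (inner) and `U` (outer). -/
def SideBound (U V g ℓ L : ℤ) : Prop :=
  L < 4 * ℓ ∨ V < 4 * ℓ ∧ (L ≤ V + g + 4 * ℓ - 1 ∨ U < 4 * ℓ ∧ L ≤ V + g + U + 2 * ℓ)

theorem no_three_sideBounds {U V W X a b c La Lb Lc Ra Rb Rc : ℤ}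
    (ha : 1 ≤ a) (hab : 5 * a + 1 ≤ b) (hbc : 5 * b + 1 ≤ c)
    (ta : 12 * a - 1 ≤ La + Ra) (tb : 12 * b - 1 ≤ Lb + Rb) (tc : 12 * c - 1 ≤ Lc + Rc)
    (la : SideBound U V 1 a La) (lb : SideBound U V 1 b Lb) (lc : SideBound U V 1 c Lc)
    (ra : SideBound X W 1 a Ra) (rb : SideBound X W 1 b Rb) (rc : SideBound X W 1 c Rc) :
    False := by
  unfold SideBound at *
  rcases la with la | ⟨la, la' | ⟨la', la''⟩⟩ <;> rcases ra with ra | ⟨ra, ra' | ⟨ra', ra''⟩⟩ <;>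
    omega

theorem no_four_sideBounds {U V W X a b c e La Lb Lc Le Ra Rb Rc Re : ℤ}
    (ha : 1 ≤ a) (hab : 5 * a + 1 ≤ b) (hbc : 5 * b + 1 ≤ c) (hce : 5 * c + 1 ≤ e)
    (ta : 12 * a - 1 ≤ La + Ra) (tb : 12 * b - 1 ≤ Lb + Rb) (tc : 12 * c - 1 ≤ Lc + Rc)
    (te : 12 * e - 1 ≤ Le + Re)
    (la : SideBound U V 2 a La) (lb : SideBound U V 2 b Lb) (lc : SideBound U V 2 c Lc)
    (le : SideBound U V 2 e Le)
    (ra : SideBound X W 2 a Ra) (rb : SideBound X W 2 b Rb) (rc : SideBound X W 2 c Rc)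
    (re : SideBound X W 2 e Re) : False := by
  unfold SideBound at *
  rcases la with la | ⟨la, la' | ⟨la', la''⟩⟩ <;> rcases ra with ra | ⟨ra, ra' | ⟨ra', ra''⟩⟩ <;>
    first | (clear lb lc le rb rc re; omega) | skip
  all_goals
    rcases lb with lb | ⟨lb, lb' | ⟨lb', lb''⟩⟩ <;>
      rcases rb with rb | ⟨rb, rb' | ⟨rb', rb''⟩⟩ <;>
      first | (clear lc le rc re; omega) | skip
  all_goals
    rcases lc with lc | ⟨lc, lc' | ⟨lc', lc''⟩⟩ <;>
      rcases rc with rc | ⟨rc, rc' | ⟨rc', rc''⟩⟩ <;>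
      first | (clear le re; omega) | omega

/-- What is known about a run of period `ℓ` on `[s, e)` relative to a good word at `[a, b)`. -/
structure PieceBound (ℓ s e a b : ℤ) : Prop where
  pre : s ≤ a → e ≤ b → e - a < 4 * ℓ
  suf : b ≤ e → a ≤ s → b - s < 4 * ℓ
  full : s ≤ a → b ≤ e → b - a < 4 * ℓ
  inside : ¬ (a ≤ s ∧ e ≤ b)

theorem pieceBound_of_good {d : ℕ} {β : ℝ} {y : ℤ → Fin d} {w : List (Fin d)} {a : ℤ}
    (ho : OccursAt y w a) (hw : w ∈ goodWords (betaFree d β)) {ℓ : ℕ} (hℓ : 1 ≤ ℓ) {s : ℤ} {n : ℕ}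
    (hn : ℓ ≤ n) (hβ : β * ℓ ≤ n) (h : RunOn y ℓ s (s + n)) :
    PieceBound ℓ s (s + n) a (a + w.length) where
  pre h1 h2 := run_prefix_lt ho hw.2.1 hℓ h2 (h.mono h1 le_rfl)
  suf h1 h2 := run_suffix_lt ho hw.2.2 hℓ h2 (h.mono le_rfl h1)
  full h1 h2 := run_prefix_lt ho hw.2.1 hℓ le_rfl (h.mono h1 h2)
  inside h1 := (run_inside_lt ho hw.1 hℓ h1.1 h1.2 hn h).not_ge hβ

theorem sideBounds_of_pieces {ℓ s e U V W X g : ℤ} (hℓ : 1 ≤ ℓ) (hg : 1 ≤ g) (hg' : g ≤ 2)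
    (hU : 0 ≤ U) (hV : 0 ≤ V) (hW : 0 ≤ W) (hX : 0 ≤ X) (hlen : 12 * ℓ - 1 + g ≤ e - s)
    (l1 : e ≤ 0 → e - s ≤ 2 * ℓ) (l2 : 0 ≤ e → 0 - s ≤ 2 * ℓ)
    (r1 : U + g + V + g + W + g + X ≤ s → e - s ≤ 2 * ℓ)
    (r2 : s ≤ U + g + V + g + W + g + X → e - (U + g + V + g + W + g + X) ≤ 2 * ℓ)
    (pu : PieceBound ℓ s e 0 U) (pv : PieceBound ℓ s e (U + g) (U + g + V))
    (pw : PieceBound ℓ s e (U + g + V + g) (U + g + V + g + W))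
    (px : PieceBound ℓ s e (U + g + V + g + W + g) (U + g + V + g + W + g + X)) :
    s ≤ U + g + V - (2 * ℓ - 1) ∧ U + g + V + g + (2 * ℓ - 1) ≤ e ∧
    SideBound U V g ℓ (U + g + V - s) ∧ SideBound X W g ℓ (e - (U + g + V + g)) := by
  obtain ⟨u1, u2, u3, u4⟩ := pu
  obtain ⟨v1, v2, v3, v4⟩ := pv
  obtain ⟨w1, w2, w3, w4⟩ := pw
  obtain ⟨x1, x2, x3, x4⟩ := px
  have he : U + g + V ≤ e := by
    clear w1 w2 w3 x1 x2 x3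
    by_contra hc
    omega
  have hs : s ≤ U + g + V + g := by
    clear u1 u2 u3 v1 v2 v3
    by_contra hc
    omega
  have hL : SideBound U V g ℓ (U + g + V - s) := by
    clear w1 w2 w3 w4 x1 x2 x3 x4
    unfold SideBound
    omega
  have hR : SideBound X W g ℓ (e - (U + g + V + g)) := by
    clear u1 u2 u3 u4 v1 v2 v3 v4
    unfold SideBound
    omega
  refine ⟨?_, ?_, hL, hR⟩
  · clear hL u1 u2 u3 u4 v1 v2 v3 v4 w1 w2 w3 w4 x1 x2 x3 x4
    unfold SideBound at hR
    omega
  · clear hR u1 u2 u3 u4 v1 v2 v3 v4 w1 w2 w3 w4 x1 x2 x3 x4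
    unfold SideBound at hL
    omega

theorem exists_middle_gap {d : ℕ} (hd : 2 ≤ d) {β : ℝ} {g k : ℕ} (Q : Fin k → List (Fin d))
    (hQ : Function.Injective Q) (hQlen : ∀ i, (Q i).length = g)
    (hβ : ∀ ℓ n : ℕ, 1 ≤ ℓ → β * ℓ ≤ n → 12 * ℓ + g ≤ n + 1)
    (hk : g = 1 ∧ k = 3 ∨ g = 2 ∧ k = 4) {u v w x r : List (Fin d)} (hr : r.length = g)
    (hu : u ∈ goodWords (betaFree d β)) (hv : v ∈ goodWords (betaFree d β))
    (hw : w ∈ goodWords (betaFree d β)) (hx : x ∈ goodWords (betaFree d β)) :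
    ∃ i, u ++ r ++ v ++ Q i ++ w ++ r ++ x ∈ language (betaFree d β) := by
  obtain ⟨t, ht⟩ := exists_overlapFree hd
  set F : Fin k → List (Fin d) := fun i => u ++ r ++ v ++ Q i ++ w ++ r ++ x with hF
  set Y : Fin k → ℤ → Fin d := fun i => extendBy t (F i) with hY
  by_contra! hcon
  have hFlen : ∀ i, ((F i).length : ℤ) =
      u.length + g + v.length + g + w.length + g + x.length := by
    intro i
    simp [hF, hr, hQlen]
    ring
  have hbad : ∀ i, Y i ∉ betaFree d β := by
    intro i hi
    exact hcon i ⟨Y i, hi, 0, occursAt_extendBy t (F i)⟩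
  choose ℓ n s hℓ hn hβn hrun using fun i => exists_run_of_notMem (hbad i)
  set m : ℤ := u.length + g + v.length with hm
  have occ : ∀ i, OccursAt (Y i) u 0 ∧ OccursAt (Y i) v (u.length + g) ∧
      OccursAt (Y i) (Q i) m ∧ OccursAt (Y i) w (m + g) ∧
      OccursAt (Y i) x (m + g + w.length + g) ∧
      OccursAt (Y i) (u ++ r ++ v) 0 ∧ OccursAt (Y i) (w ++ r ++ x) (m + g) := by
    intro i
    have h0 : OccursAt (Y i) (F i) 0 := occursAt_extendBy t (F i)
    have h1 := h0
    simp only [hF] at h0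
    obtain ⟨h0, ox⟩ := h0.append
    obtain ⟨h0, -⟩ := h0.append
    obtain ⟨h0, ow⟩ := h0.append
    obtain ⟨h0, oq⟩ := h0.append
    have huv := h0
    obtain ⟨h0, ov⟩ := h0.append
    obtain ⟨ou, -⟩ := h0.append
    have hr1 : F i = (u ++ r ++ v ++ Q i) ++ (w ++ r ++ x) := by simp [hF]
    rw [hr1] at h1
    have h2 := h1.append.2
    simp only [List.length_append, hr, hQlen, Nat.cast_add, zero_add] at *
    refine ⟨ou, ov, oq, ow, ?_, huv, h2⟩
    exact ox
  have bounds : ∀ i, s i ≤ m - (2 * ℓ i - 1) ∧ m + g + (2 * ℓ i - 1) ≤ s i + n i ∧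
      SideBound u.length v.length g (ℓ i) (m - s i) ∧
      SideBound x.length w.length g (ℓ i) (s i + n i - (m + g)) := by
    intro i
    obtain ⟨ou, ov, -, ow, ox, -⟩ := occ i
    have hlen := hβ (ℓ i) (n i) (hℓ i) (hβn i)
    have pu := pieceBound_of_good ou hu (hℓ i) (hn i) (hβn i) (hrun i)
    rw [zero_add] at pu
    have hℓi := hℓ i
    refine sideBounds_of_pieces (by omega) (by omega) (by omega) (by omega) (by omega) (by omega)
      (by omega) (by omega) ?_ ?_ ?_ ?_ pu
      (pieceBound_of_good ov hv (hℓ i) (hn i) (hβn i) (hrun i))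
      (pieceBound_of_good ow hw (hℓ i) (hn i) (hβn i) (hrun i))
      (pieceBound_of_good ox hx (hℓ i) (hn i) (hβn i) (hrun i))
    · exact fun h => run_left_le ht (F i) (hℓ i) h (hrun i)
    · exact fun h => run_left_le ht (F i) (hℓ i) le_rfl ((hrun i).mono le_rfl h)
    · exact fun h => run_right_le ht (F i) (hℓ i) (by rw [hFlen]; exact h) (hrun i)
    · exact fun h => run_right_le ht (F i) (hℓ i) (by rw [hFlen]) ((hrun i).mono h le_rfl)
  have total : ∀ i, 12 * (ℓ i : ℤ) - 1 ≤ (m - s i) + (s i + n i - (m + g)) := by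
    intro i
    have := hβ (ℓ i) (n i) (hℓ i) (hβn i)
    omega
  have agree_left : ∀ i j, ∀ z < m, Y i z = Y j z := by
    intro i j z hz
    rcases lt_or_ge z 0 with h | h
    · simp only [hY]
      rw [extendBy_of_notMem _ _ (Or.inl h), extendBy_of_notMem _ _ (Or.inl h)]
    · have hz' : z.toNat < (u ++ r ++ v).length := by simp [hr]; omega
      have h1 := (occ i).2.2.2.2.2.1 z.toNat hz'
      have h2 := (occ j).2.2.2.2.2.1 z.toNat hz'
      rw [show (0 : ℤ) + z.toNat = z by omega] at h1 h2
      rw [h1, h2]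
  have agree_right : ∀ i j, ∀ z, m + g ≤ z → Y i z = Y j z := by
    intro i j z hz
    by_cases h : z < (F i).length
    · rw [hFlen] at h
      have hz' : (z - (m + g)).toNat < (w ++ r ++ x).length := by simp [hr]; omega
      have h1 := (occ i).2.2.2.2.2.2 _ hz'
      have h2 := (occ j).2.2.2.2.2.2 _ hz'
      rw [show m + g + ((z - (m + g)).toNat : ℤ) = z by omega] at h1 h2
      rw [h1, h2]
    · have h' : ((F j).length : ℤ) ≤ z := by rw [hFlen] at *; omega
      simp only [hY]
      rw [extendBy_of_notMem _ _ (Or.inr (by omega)), extendBy_of_notMem _ _ (Or.inr h')]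
  have eq_of_agree : ∀ i j, (∀ a : ℕ, a < g → Y i (m + a) = Y j (m + a)) → i = j := by
    intro i j h
    apply hQ
    apply List.ext_getElem (by simp [hQlen])
    intro a h1 h2
    rw [← (occ i).2.2.1, ← (occ j).2.2.1]
    exact h a (by rwa [hQlen] at h1)
  have hinj : Function.Injective ℓ := by
    intro i j hij
    have bi := bounds i
    have bj := bounds j
    have hi := hℓ i
    have rj := hrun j
    rw [← hij] at rj bj
    exact eq_of_agree i j (eq_of_runs_same (hℓ i) (agree_left i j) (hrun i) rj (by omega)
      (by omega) (by omega) (by omega))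
  have hgrow : ∀ i j, ℓ i < ℓ j → 5 * (ℓ i : ℤ) + 1 ≤ ℓ j := by
    intro i j hij
    obtain ⟨bi1, bi2, -⟩ := bounds i
    obtain ⟨bj1, bj2, -⟩ := bounds j
    have hi := hℓ i
    have hj := hℓ j
    have hne : i ≠ j := by rintro rfl; omega
    have ti := total i
    have hs : ¬ s i ≤ m - ℓ i - ℓ j := fun h => hne <| eq_of_agree i j <|
      eq_of_runs_left hi hj (agree_left i j) (hrun i) (hrun j) h (by omega) (by omega) (by omega)
    have he : ¬ m + g + ℓ i + ℓ j ≤ s i + n i := fun h => hne <| eq_of_agree i j <|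
      eq_of_runs_right hi hj (agree_right i j) (hrun i) (hrun j) (by omega) (by omega) h (by omega)
    omega
  have hmono : StrictMono (ℓ ∘ Tuple.sort ℓ) :=
    (Tuple.monotone_sort ℓ).strictMono_of_injective (hinj.comp (Tuple.sort ℓ).injective)
  set σ := Tuple.sort ℓ
  have hgrow' : ∀ a b, a < b → 5 * (ℓ (σ a) : ℤ) + 1 ≤ ℓ (σ b) :=
    fun a b hab => hgrow _ _ (hmono hab)
  have one_le : ∀ i, (1 : ℤ) ≤ ℓ i := fun i => by exact_mod_cast hℓ i
  rcases hk with ⟨rfl, rfl⟩ | ⟨rfl, rfl⟩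
  · exact no_three_sideBounds (one_le (σ 0)) (hgrow' 0 1 (by decide)) (hgrow' 1 2 (by decide))
      (total _) (total _) (total _) (bounds _).2.2.1 (bounds _).2.2.1 (bounds _).2.2.1
      (bounds _).2.2.2 (bounds _).2.2.2 (bounds _).2.2.2
  · exact no_four_sideBounds (one_le (σ 0)) (hgrow' 0 1 (by decide)) (hgrow' 1 2 (by decide))
      (hgrow' 2 3 (by decide)) (total _) (total _) (total _) (total _)
      (bounds _).2.2.1 (bounds _).2.2.1 (bounds _).2.2.1 (bounds _).2.2.1
      (bounds _).2.2.2 (bounds _).2.2.2 (bounds _).2.2.2 (bounds _).2.2.2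

/-- Variable-length specification for four good words: one-symbol gaps when
`d ≥ 3`, `β ≥ 12`; two-symbol gaps when `d = 2`, `β > 12`. -/
theorem spec_four_words (d : ℕ) (β : ℝ) :
    (3 ≤ d → 12 ≤ β →
      ∀ u v w x : List (Fin d),
        u ∈ goodWords (betaFree d β) → v ∈ goodWords (betaFree d β) →
        w ∈ goodWords (betaFree d β) → x ∈ goodWords (betaFree d β) →
        ∃ a b c : Fin d,
          u ++ [a] ++ v ++ [b] ++ w ++ [c] ++ x ∈ language (betaFree d β)) ∧
    (d = 2 → 12 < β →
      ∀ u v w x : List (Fin d),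
        u ∈ goodWords (betaFree d β) → v ∈ goodWords (betaFree d β) →
        w ∈ goodWords (betaFree d β) → x ∈ goodWords (betaFree d β) →
        ∃ p q r : List (Fin d), p.length = 2 ∧ q.length = 2 ∧ r.length = 2 ∧
          u ++ p ++ v ++ q ++ w ++ r ++ x ∈ language (betaFree d β)) := by
  constructor
  · intro hd hβ u v w x hu hv hw hx
    have hQ : Function.Injective (fun i : Fin 3 => [Fin.castLE hd i]) := by
      intro i j h
      simpa using h
    obtain ⟨i, hi⟩ := exists_middle_gap (by omega) (g := 1) _ hQ (fun _ => rfl)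
      (fun ℓ n _ h => by
        have h1 : (12 : ℝ) * ℓ ≤ n := le_trans (by gcongr) h
        have h2 : 12 * ℓ ≤ n := by exact_mod_cast h1
        omega) (by simp) (r := [⟨0, by omega⟩]) rfl hu hv hw hx
    exact ⟨_, _, _, hi⟩
  · rintro rfl hβ u v w x hu hv hw hx
    have hQ : Function.Injective
        (![[0, 0], [0, 1], [1, 0], [1, 1]] : Fin 4 → List (Fin 2)) := by decide
    obtain ⟨i, hi⟩ := exists_middle_gap le_rfl (g := 2) _ hQ (by decide)
      (fun ℓ n hℓ h => by
        have h0 : (0 : ℝ) < ℓ := by exact_mod_cast hℓ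
        have h1 : (12 : ℝ) * ℓ < n := lt_of_lt_of_le (by gcongr) h
        have h2 : 12 * ℓ < n := by exact_mod_cast h1
        omega) (by simp) (r := [0, 0]) rfl hu hv hw hx
    exact ⟨_, _, _, rfl, by clear hi; revert i; decide, rfl, hi⟩
end

section
/- Let X be a shift space on a finite alphabet with language L and topological entropy h. Suppose G ⊆ L satisfies: there exists τ ∈ ℕ such that for every k, n ∈ ℕ and all w⁽¹⁾, …, w⁽ᵏ⁾ ∈ G of length n, there exist u⁽¹⁾, …, u⁽ᵏ⁻¹⁾ ∈ L_τ with w⁽¹⁾u⁽¹⁾w⁽²⁾⋯u⁽ᵏ⁻¹⁾w⁽ᵏ⁾ ∈ L. Then #G_n ≤ e^{(n+τ)h} for all n ∈ ℕ, where G_n is the set of words of length n in G. -/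
open MeasureTheory Filter Real Set

theorem alternate_length {A : Type*} {n τ : ℕ} :
    ∀ (ws us : List (List A)), ws.length = us.length + 1 →
      (∀ w ∈ ws, w.length = n) → (∀ u ∈ us, u.length = τ) →
      (alternate ws us).length = us.length * (n + τ) + n
  | [], _, h, _, _ => by simp at h
  | [w], [], _, hw, _ => by simp [alternate, hw w]
  | _ :: _ :: _, [], h, _, _ => by simp at h
  | w :: ws, u :: us, h, hw, hu => by
    have ih := alternate_length (n := n) (τ := τ) ws us (by simpa using h)
      (fun x hx => hw x (List.mem_cons_of_mem _ hx))
      (fun x hx => hu x (List.mem_cons_of_mem _ hx))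
    simp only [alternate, List.length_append, List.length_cons, ih, hw w List.mem_cons_self,
      hu u List.mem_cons_self]
    ring

/-- A concatenation of words of length `n` separated by words of length `τ` determines
the words of length `n`. -/
theorem alternate_left_inj {A : Type*} {n τ : ℕ} :
    ∀ (ws us ws' us' : List (List A)), ws.length = us.length + 1 → ws'.length = us'.length + 1 →
      us.length = us'.length →
      (∀ w ∈ ws, w.length = n) → (∀ u ∈ us, u.length = τ) →
      (∀ w ∈ ws', w.length = n) → (∀ u ∈ us', u.length = τ) →
      alternate ws us = alternate ws' us' → ws = ws'
  | [], _, _, _, h, _, _, _, _, _, _, _ => by simp at h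
  | _, _, [], _, _, h, _, _, _, _, _, _ => by simp at h
  | _ :: _, _ :: _, _, [], _, _, h, _, _, _, _, _ => by simp at h
  | _ :: _, [], _, _ :: _, _, _, h, _, _, _, _, _ => by simp at h
  | w :: ws, [], w' :: ws', [], h, h', _, _, _, _, _, e => by
    have h1 : ws = [] := by simpa using h
    have h2 : ws' = [] := by simpa using h'
    subst h1 h2
    simpa [alternate] using e
  | w :: ws, u :: us, w' :: ws', u' :: us', h, h', hl, hw, hu, hw', hu', e => by
    simp only [alternate, List.append_assoc] at e
    obtain ⟨e1, e2⟩ := List.append_inj e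
      ((hw w List.mem_cons_self).trans (hw' w' List.mem_cons_self).symm)
    obtain ⟨-, e3⟩ := List.append_inj e2
      ((hu u List.mem_cons_self).trans (hu' u' List.mem_cons_self).symm)
    rw [e1, alternate_left_inj (n := n) (τ := τ) ws us ws' us' (by simpa using h)
      (by simpa using h') (by simpa using hl)
      (fun x hx => hw x (List.mem_cons_of_mem _ hx))
      (fun x hx => hu x (List.mem_cons_of_mem _ hx))
      (fun x hx => hw' x (List.mem_cons_of_mem _ hx))
      (fun x hx => hu' x (List.mem_cons_of_mem _ hx)) e3]

theorem langN_finite {A : Type*} [Finite A] (X : Set (ℤ → A)) (n : ℕ) : (langN X n).Finite :=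
  (List.finite_length_eq A n).subset fun _ hw => hw.2

theorem ncard_pow_le_of_spec {A : Type*} [Finite A] (X : Set (ℤ → A)) (G : Set (List A))
    (τ n k : ℕ)
    (hspec : ∀ ws : List (List A), ws.length = k + 1 → (∀ w ∈ ws, w ∈ G ∧ w.length = n) →
      ∃ us : List (List A), us.length = k ∧ (∀ u ∈ us, u ∈ langN X τ) ∧
        alternate ws us ∈ language X) :
    {w ∈ G | w.length = n}.ncard ^ (k + 1) ≤ (langN X (k * (n + τ) + n)).ncard := by
  set S := {w ∈ G | w.length = n} with hS
  have hfin : Finite (langN X (k * (n + τ) + n)) := langN_finite X _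
  have hws : ∀ v : Fin (k + 1) → S, ∀ w ∈ List.ofFn (fun i => (v i : List A)),
      w ∈ G ∧ w.length = n := by
    intro v w hw
    obtain ⟨i, rfl⟩ := (List.mem_ofFn' _ _).1 hw
    exact (v i).2
  choose us hlen hmem hlang using fun v : Fin (k + 1) → S =>
    hspec (List.ofFn fun i => (v i : List A)) (by simp) (hws v)
  let f : (Fin (k + 1) → S) → langN X (k * (n + τ) + n) := fun v =>
    ⟨alternate (List.ofFn fun i => (v i : List A)) (us v), hlang v, by
      rw [alternate_length (n := n) (τ := τ) _ _ (by simp [hlen]) (fun w hw => (hws v w hw).2)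
        (fun u hu => (hmem v u hu).2), hlen]⟩
  have hf : Function.Injective f := by
    intro v v' e
    have e' := alternate_left_inj (n := n) (τ := τ) _ _ _ _ (by simp [hlen]) (by simp [hlen])
      (by simp [hlen]) (fun w hw => (hws v w hw).2) (fun u hu => (hmem v u hu).2)
      (fun w hw => (hws v' w hw).2) (fun u hu => (hmem v' u hu).2) (congrArg Subtype.val e)
    funext i
    exact Subtype.ext (congrFun (List.ofFn_injective e') i)
  have hc := Nat.card_le_card_of_injective f hf
  rwa [Nat.card_fun, Nat.card_fin, Nat.card_coe_set_eq, Nat.card_coe_set_eq] at hc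

/-- Multi-step same-length specification bounds the number of good words:
`#G_n ≤ e^{(n+τ)h}`. -/
theorem good_words_le_of_spec {A : Type*} [Fintype A]
    [TopologicalSpace A] [DiscreteTopology A]
    (X : Set (ℤ → A)) (hX : IsShiftSpace X) (h : ℝ)
    (hEnt : Tendsto (fun n : ℕ => Real.log ((langN X n).ncard) / n) atTop (nhds h))
    (G : Set (List A)) (hG : G ⊆ language X) (τ : ℕ)
    (hIV : ∀ k n : ℕ, 1 ≤ k → ∀ ws : List (List A), ws.length = k →
      (∀ w ∈ ws, w ∈ G ∧ w.length = n) →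
      ∃ us : List (List A), us.length = k - 1 ∧ (∀ u ∈ us, u ∈ langN X τ) ∧
        alternate ws us ∈ language X) :
    ∀ n : ℕ, (({w ∈ G | w.length = n}).ncard : ℝ) ≤ Real.exp ((n + τ) * h) := by
  intro n
  set g := {w ∈ G | w.length = n}.ncard with hg
  rcases Nat.eq_zero_or_pos g with h0 | hpos
  · rw [h0, Nat.cast_zero]
    exact (Real.exp_pos _).le
  have hpos' : (0 : ℝ) < g := by exact_mod_cast hpos
  rcases Nat.eq_zero_or_pos (n + τ) with hnτ | hnτ
  · obtain ⟨rfl, rfl⟩ : n = 0 ∧ τ = 0 := by omega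
    have : g ≤ 1 := by
      rw [← Set.ncard_singleton ([] : List A)]
      exact Set.ncard_le_ncard (fun w hw => List.length_eq_zero_iff.1 hw.2)
    simpa using this
  have hnτ' : (0 : ℝ) < n + τ := by exact_mod_cast hnτ
  have hlog : 0 ≤ Real.log g := Real.log_natCast_nonneg g
  have hm : Tendsto (fun k : ℕ => k * (n + τ) + n) atTop atTop :=
    tendsto_atTop_mono (fun k => (Nat.le_mul_of_pos_right k hnτ).trans (Nat.le_add_right _ _))
      tendsto_id
  have hle : Real.log g / (n + τ) ≤ h := by
    refine ge_of_tendsto (hEnt.comp hm) ?_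
    filter_upwards [eventually_ge_atTop 1] with k hk
    have hcard : g ^ (k + 1) ≤ (langN X (k * (n + τ) + n)).ncard :=
      ncard_pow_le_of_spec X G τ n k fun ws hl hw => by
        simpa using hIV (k + 1) n (by omega) ws hl hw
    have hlogs : (k + 1) * Real.log g ≤
        Real.log ((langN X (k * (n + τ) + n)).ncard) := by
      have := Real.log_le_log (by positivity : (0 : ℝ) < (g : ℝ) ^ (k + 1))
        (by exact_mod_cast hcard : (g : ℝ) ^ (k + 1) ≤ (langN X (k * (n + τ) + n)).ncard)
      rw [Real.log_pow] at this
      exact_mod_cast this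
    have hk' : (1 : ℝ) ≤ k := by exact_mod_cast hk
    simp only [Function.comp_apply, Nat.cast_add, Nat.cast_mul]
    rw [div_le_div_iff₀ hnτ' (by positivity)]
    have hτ : (0 : ℝ) ≤ τ := Nat.cast_nonneg τ
    calc Real.log g * (k * (n + τ) + n) ≤ (k + 1) * Real.log g * (n + τ) := by
          nlinarith [mul_nonneg hlog hτ]
      _ ≤ _ := mul_le_mul_of_nonneg_right hlogs hnτ'.le
  rw [← Real.log_le_iff_le_exp hpos', mul_comm]
  exact (div_le_iff₀ hnτ').1 hle
end
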